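/- arXiv:2207.08422 — 6 statements merged into one kernel-verified Lean document; each statement's English description precedes it below -/
import Mathlib

section
/- Let T > 0, H ∈ (0,1), C > 0, m ≥ 1, and let R : [0,T]² → ℝ be symmetric, continuous, positive semidefinite (i.e. ∑_{i,j} c_i c_j R(t_i, t_j) ≥ 0 for all finite real combinations), with R(0, t) = 0 for all t, such that for each t ∈ (0,T] the map s ↦ R(s,t) is differentiable at every s ∈ (0,T] \ {t} with |∂₁R(s,t)| ≤ C(|t − s|^{2H−1} + s^{2H−1}). Let Q_m denote the bilinear form on elementary functions on [0,T]^m determined by Q_m(𝟙_{[0,s₁)×⋯×[0,s_m)}, 𝟙_{[0,t₁)×⋯×[0,t_m)}) = ∏_{i=1}^m R(s_i, t_i). If (f_n) is a sequence of elementary functions on [0,T]^m which is uniformly bounded in supremum norm, converges to 0 Lebesgue-almost everywhere on [0,T]^m, and is Cauchy with respect to Q_m (i.e. Q_m(f_n − f_k, f_n − f_k) → 0 as n, k → ∞), then Q_m(f_n, f_n) → 0 as n → ∞. -/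
open MeasureTheory Filter

/-- The elementary function on `[0,T]^m` represented by a formal linear combination
`c` of boxes: `c` assigns to each `t : Fin m → ℝ` the coefficient of the indicator of
the box `[0,t₁) × ⋯ × [0,t_m)`. -/
noncomputable def elemFun {m : ℕ} (c : (Fin m → ℝ) →₀ ℝ) (u : Fin m → ℝ) : ℝ :=
  c.sum fun t a => a * ∏ i, Set.indicator (Set.Ico 0 (t i)) (fun _ => (1:ℝ)) (u i)

/-- The bilinear form `Q_m` determined by
`Q_m(𝟙_{[0,s₁)×⋯×[0,s_m)}, 𝟙_{[0,t₁)×⋯×[0,t_m)}) = ∏ᵢ R(sᵢ, tᵢ)`,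
evaluated on formal linear combinations of boxes. -/
noncomputable def Qform {m : ℕ} (R : ℝ → ℝ → ℝ) (c c' : (Fin m → ℝ) →₀ ℝ) : ℝ :=
  c.sum fun t a => c'.sum fun t' b => a * b * ∏ i, R (t i) (t' i)

open Matrix in
/-- Entrywise finite products of positive semidefinite real matrices are positive semidefinite. -/
lemma posSemidef_entrywise_prod {ι κ : Type*} [Finite ι] (A : κ → Matrix ι ι ℝ)
    (hA : ∀ k, (A k).PosSemidef) (s : Finset κ) :
    (Matrix.of fun i j => ∏ k ∈ s, A k i j).PosSemidef := by
  classical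
  induction s using Finset.induction_on with
  | empty =>
    convert posSemidef_vecMulVec_self_star (fun _ : ι => (1 : ℝ)) using 1
    ext i j
    simp [vecMulVec_apply]
  | insert k s hk ih =>
    have h : (Matrix.of fun i j => ∏ k ∈ insert k s, A k i j) =
        A k ⊙ Matrix.of fun i j => ∏ k ∈ s, A k i j := by
      ext i j
      simp [hadamard_apply, Finset.prod_insert hk]
    rw [h]
    exact (hA k).hadamard ih

lemma Qform_sub_left {m : ℕ} (R : ℝ → ℝ → ℝ) (a b c : (Fin m → ℝ) →₀ ℝ) :
    Qform R (a - b) c = Qform R a c - Qform R b c := by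
  unfold Qform
  apply Finsupp.sum_sub_index
  intro t x y
  simp only [Finsupp.sum, ← Finset.sum_sub_distrib]
  exact Finset.sum_congr rfl fun _ _ => by ring

lemma Qform_comm {m : ℕ} {R : ℝ → ℝ → ℝ} (hsymm : ∀ s t : ℝ, R s t = R t s)
    (a b : (Fin m → ℝ) →₀ ℝ) : Qform R a b = Qform R b a := by
  simp only [Qform, Finsupp.sum]
  rw [Finset.sum_comm]
  refine Finset.sum_congr rfl fun t _ => Finset.sum_congr rfl fun t' _ => ?_
  rw [mul_comm (a t')]
  simp only [hsymm]

lemma Qform_sub_self {m : ℕ} {R : ℝ → ℝ → ℝ} (hsymm : ∀ s t : ℝ, R s t = R t s)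
    (a b : (Fin m → ℝ) →₀ ℝ) :
    Qform R (a - b) (a - b) = Qform R a a - 2 * Qform R a b + Qform R b b := by
  rw [Qform_sub_left, Qform_comm hsymm a, Qform_comm hsymm b, Qform_sub_left, Qform_sub_left,
    Qform_comm hsymm b a]
  ring

lemma Qform_self_nonneg {m : ℕ} {T : ℝ} {R : ℝ → ℝ → ℝ}
    (hsymm : ∀ s t : ℝ, R s t = R t s)
    (hpsd : ∀ (k : ℕ) (a : Fin k → ℝ) (ts : Fin k → ℝ), (∀ i, ts i ∈ Set.Icc (0:ℝ) T) →
      0 ≤ ∑ i, ∑ j, a i * a j * R (ts i) (ts j))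
    (c : (Fin m → ℝ) →₀ ℝ) (hc : ∀ t ∈ c.support, ∀ i, t i ∈ Set.Icc (0:ℝ) T) :
    0 ≤ Qform R c c := by
  have key : ∀ i : Fin m, (Matrix.of fun t t' : c.support =>
      R (t.1 i) (t'.1 i)).PosSemidef := by
    intro i
    refine Matrix.PosSemidef.of_dotProduct_mulVec_nonneg ?_ fun x => ?_
    · ext t t'
      simp [hsymm (t.1 i)]
    · have e := c.support.equivFin.symm
      have h := hpsd _ (fun k => x (e k)) (fun k => (e k).1 i) fun k => hc _ (e k).2 i
      rw [e.sum_comp (fun t => ∑ j, x t * x (e j) * R (t.1 i) ((e j).1 i))] at h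
      simp_rw [fun t : c.support => e.sum_comp (fun t' => x t * x t' * R (t.1 i) (t'.1 i))] at h
      simp only [dotProduct, Matrix.mulVec, Matrix.of_apply, Finset.mul_sum, star_trivial]
      refine h.trans_eq (Finset.sum_congr rfl fun _ _ => Finset.sum_congr rfl fun _ _ => by ring)
  have h := (posSemidef_entrywise_prod _ key Finset.univ).dotProduct_mulVec_nonneg
    (fun t => c t.1)
  simp only [dotProduct, Matrix.mulVec, Matrix.of_apply, Finset.mul_sum, star_trivial] at h
  simp only [Qform, Finsupp.sum]
  rw [← Finset.sum_coe_sort]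
  refine h.trans_eq (Finset.sum_congr rfl fun t _ => ?_)
  rw [← Finset.sum_coe_sort c.support]
  exact Finset.sum_congr rfl fun _ _ => by ring

/-- The derivative bound makes `R · t` the primitive of an integrable function. -/
lemma exists_integrable_density {T H C : ℝ} (hH0 : 0 < H)
    {r d : ℝ → ℝ} {t : ℝ}
    (hcont : ContinuousOn r (Set.Icc 0 T)) (hzero : r 0 = 0)
    (hd : ∀ s ∈ Set.Ioc (0:ℝ) T, s ≠ t → HasDerivAt r (d s) s ∧
      |d s| ≤ C * (|t - s| ^ (2*H - 1) + s ^ (2*H - 1))) (hC : 0 < C) :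
    ∃ g : ℝ → ℝ, Integrable g ∧ (∀ u ∉ Set.Icc 0 T, g u = 0) ∧
      ∀ s ∈ Set.Icc 0 T, r s = ∫ u, Set.indicator (Set.Ico 0 s) (fun _ => (1:ℝ)) u * g u := by
  rcases le_or_gt T 0 with hT | hT
  · refine ⟨0, integrable_zero _ _ _, fun _ _ => rfl, fun s hs => ?_⟩
    obtain rfl : s = 0 := le_antisymm (hs.2.trans hT) hs.1
    simpa using hzero
  have hp : -1 < 2 * H - 1 := by linarith
  have hint : IntegrableOn (deriv r) (Set.Ioc 0 T) := by
    have h1 : IntegrableOn (fun s : ℝ => s ^ (2*H - 1)) (Set.Ioc 0 T) :=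
      (intervalIntegrable_iff_integrableOn_Ioc_of_le hT.le).1
        (intervalIntegral.intervalIntegrable_rpow' hp)
    have h2 : IntegrableOn (fun s : ℝ => (s - t) ^ (2*H - 1)) (Set.Ioc 0 T) := by
      rw [← intervalIntegrable_iff_integrableOn_Ioc_of_le hT.le]
      simpa using (intervalIntegral.intervalIntegrable_rpow' (a := 0 - t) (b := T - t)
        hp).comp_sub_right t
    have h3 : IntegrableOn (fun s : ℝ => (t - s) ^ (2*H - 1)) (Set.Ioc 0 T) := by
      rw [← intervalIntegrable_iff_integrableOn_Ioc_of_le hT.le]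
      simpa using (intervalIntegral.intervalIntegrable_rpow' (a := t - 0) (b := t - T)
        hp).comp_sub_left t
    have hb := ((h2.norm.add h3.norm).add h1).const_mul C
    refine Integrable.mono' hb (measurable_deriv r).aestronglyMeasurable ?_
    have hne : ∀ᵐ s ∂(volume.restrict (Set.Ioc 0 T)), s ≠ t :=
      ae_restrict_of_ae (by simp [ae_iff])
    filter_upwards [hne, ae_restrict_mem measurableSet_Ioc] with s hs hsT
    obtain ⟨hd1, hd2⟩ := hd s hsT hs
    rw [hd1.deriv, Real.norm_eq_abs]
    refine hd2.trans ?_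
    simp only [Pi.add_apply]
    gcongr
    rcases le_total s t with h | h
    · rw [abs_of_nonneg (sub_nonneg.2 h)]
      exact (le_abs_self _).trans (le_add_of_nonneg_left (norm_nonneg _))
    · rw [abs_of_nonpos (sub_nonpos.2 h), neg_sub]
      exact (le_abs_self _).trans (le_add_of_nonneg_right (norm_nonneg _))
  refine ⟨(Set.Ioc 0 T).indicator (deriv r), (integrable_indicator_iff measurableSet_Ioc).2 hint,
    fun u hu => Set.indicator_of_notMem (fun h => hu (Set.Ioc_subset_Icc_self h)) _,
    fun s hs => ?_⟩
  have hsub : Set.Ioc 0 s ⊆ Set.Ioc 0 T := Set.Ioc_subset_Ioc_right hs.2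
  have hftc := integral_eq_of_hasDerivAt_off_countable_of_le r (deriv r) hs.1
    (Set.countable_singleton t) (hcont.mono (Set.Icc_subset_Icc_right hs.2))
    (fun x hx => by
      have h := (hd x (hsub (Set.Ioo_subset_Ioc_self hx.1)) hx.2).1
      exact h.differentiableAt.hasDerivAt)
    ((intervalIntegrable_iff_integrableOn_Ioc_of_le hs.1).2 (hint.mono_set hsub))
  rw [hzero, sub_zero, intervalIntegral.integral_of_le hs.1] at hftc
  rw [← hftc, ← integral_indicator measurableSet_Ioc]
  refine integral_congr_ae ?_
  have h0 : ∀ᵐ u : ℝ, u ≠ 0 := by simp [ae_iff]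
  have h1 : ∀ᵐ u : ℝ, u ≠ s := by simp [ae_iff]
  filter_upwards [h0, h1] with u hu0 hus
  by_cases hu : u ∈ Set.Ioc 0 s
  · have : u ∈ Set.Ico 0 s := ⟨hu.1.le, lt_of_le_of_ne hu.2 hus⟩
    simp [hu, this, hsub hu]
  · have : u ∉ Set.Ico 0 s := fun h => hu ⟨lt_of_le_of_ne h.1 hu0.symm, h.2.le⟩
    simp [hu, this]

/-- If each `r i` is the primitive of `g i`, the product functional on elementary functions is
integration against `∏ i, g i`. -/
lemma sum_mul_prod_eq_integral {m : ℕ} {T : ℝ} {r g : Fin m → ℝ → ℝ}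
    (hg : ∀ i, Integrable (g i))
    (hr : ∀ i, ∀ s ∈ Set.Icc 0 T,
      r i s = ∫ u, Set.indicator (Set.Ico 0 s) (fun _ => (1:ℝ)) u * g i u)
    (c : (Fin m → ℝ) →₀ ℝ) (hc : ∀ t ∈ c.support, ∀ i, t i ∈ Set.Icc (0:ℝ) T) :
    (c.sum fun t a => a * ∏ i, r i (t i)) = ∫ u, elemFun c u * ∏ i, g i (u i) := by
  have hind : ∀ (i : Fin m) (s : ℝ), Integrable fun u =>
      Set.indicator (Set.Ico 0 s) (fun _ => (1:ℝ)) u * g i u := by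
    intro i s
    simpa [← Set.indicator_mul_left] using
      (hg i).indicator (measurableSet_Ico (a := (0:ℝ)) (b := s))
  simp only [elemFun, Finsupp.sum, Finset.sum_mul, mul_assoc, ← Finset.prod_mul_distrib]
  rw [integral_finsetSum]
  · refine Finset.sum_congr rfl fun t ht => ?_
    rw [integral_const_mul, integral_fintype_prod_volume_eq_prod
      (fun i x => Set.indicator (Set.Ico 0 (t i)) (fun _ => (1:ℝ)) x * g i x)]
    exact congrArg _ (Finset.prod_congr rfl fun i _ => hr i _ (hc t ht i))
  · intro t _
    exact (Integrable.fintype_prod fun i => hind i (t i)).const_mul _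

lemma measurable_elemFun {m : ℕ} (c : (Fin m → ℝ) →₀ ℝ) : Measurable (elemFun c) := by
  unfold elemFun Finsupp.sum
  refine Finset.measurable_sum _ fun t _ => measurable_const.mul ?_
  exact Finset.measurable_prod _ fun i _ =>
    (measurable_const.indicator measurableSet_Ico).comp (measurable_pi_apply i)

lemma tendsto_integral_elemFun_mul_prod {m : ℕ} {T M : ℝ} {g : Fin m → ℝ → ℝ}
    (hg : ∀ i, Integrable (g i)) (hg0 : ∀ i, ∀ u ∉ Set.Icc 0 T, g i u = 0)
    (f : ℕ → ((Fin m → ℝ) →₀ ℝ)) (hbdd : ∀ (n : ℕ) (u : Fin m → ℝ), |elemFun (f n) u| ≤ M)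
    (hae : ∀ᵐ u ∂(volume : Measure (Fin m → ℝ)), (∀ i, u i ∈ Set.Icc (0:ℝ) T) →
      Tendsto (fun n => elemFun (f n) u) atTop (nhds 0)) :
    Tendsto (fun n => ∫ u, elemFun (f n) u * ∏ i, g i (u i)) atTop (nhds 0) := by
  have hG : Integrable (fun u : Fin m → ℝ => ∏ i, g i (u i)) := Integrable.fintype_prod hg
  have h := tendsto_integral_of_dominated_convergence
    (F := fun n (u : Fin m → ℝ) => elemFun (f n) u * ∏ i, g i (u i)) (f := fun _ => (0:ℝ))
    (fun u => M * ‖∏ i, g i (u i)‖)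
    (fun n => (measurable_elemFun (f n)).aestronglyMeasurable.mul hG.aestronglyMeasurable)
    (hG.norm.const_mul M)
    (fun n => Eventually.of_forall fun u => by
      rw [norm_mul]
      exact mul_le_mul_of_nonneg_right (hbdd n u) (norm_nonneg _))
    (by
      filter_upwards [hae] with u hu
      by_cases h : ∀ i, u i ∈ Set.Icc (0:ℝ) T
      · simpa using (hu h).mul_const (∏ i, g i (u i))
      · obtain ⟨i, hi⟩ := not_forall.1 h
        have h0 : ∏ i, g i (u i) = 0 := Finset.prod_eq_zero (Finset.mem_univ i) (hg0 i _ hi)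
        simp [h0])
  simpa using h

/-- If `(f_n)` is a sequence of elementary functions on `[0,T]^m`,
uniformly bounded in sup norm, converging to `0` Lebesgue-a.e. on `[0,T]^m`, and Cauchy
with respect to `Q_m`, then `Q_m(f_n, f_n) → 0`. -/
theorem stmt1 (T H C : ℝ) (hT : 0 < T) (hH0 : 0 < H) (hH1 : H < 1) (hC : 0 < C)
    (m : ℕ) (hm : 1 ≤ m)
    (R : ℝ → ℝ → ℝ)
    (hsymm : ∀ s t : ℝ, R s t = R t s)
    (hcont : ContinuousOn (fun p : ℝ × ℝ => R p.1 p.2) (Set.Icc 0 T ×ˢ Set.Icc 0 T))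
    (hpsd : ∀ (k : ℕ) (a : Fin k → ℝ) (ts : Fin k → ℝ), (∀ i, ts i ∈ Set.Icc (0:ℝ) T) →
      0 ≤ ∑ i, ∑ j, a i * a j * R (ts i) (ts j))
    (hzero : ∀ t ∈ Set.Icc (0:ℝ) T, R 0 t = 0)
    (D : ℝ → ℝ → ℝ)
    (hD : ∀ t ∈ Set.Ioc (0:ℝ) T, ∀ s ∈ Set.Ioc (0:ℝ) T, s ≠ t →
      HasDerivAt (fun x => R x t) (D s t) s ∧
      |D s t| ≤ C * (|t - s| ^ (2*H - 1) + s ^ (2*H - 1)))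
    (f : ℕ → ((Fin m → ℝ) →₀ ℝ))
    (hsupp : ∀ n : ℕ, ∀ t ∈ (f n).support, ∀ i, t i ∈ Set.Icc (0:ℝ) T)
    (M : ℝ) (hbdd : ∀ (n : ℕ) (u : Fin m → ℝ), |elemFun (f n) u| ≤ M)
    (hae : ∀ᵐ u ∂(volume : Measure (Fin m → ℝ)), (∀ i, u i ∈ Set.Icc (0:ℝ) T) →
      Tendsto (fun n => elemFun (f n) u) atTop (nhds 0))
    (hcauchy : Tendsto (fun p : ℕ × ℕ => Qform R (f p.1 - f p.2) (f p.1 - f p.2))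
      atTop (nhds 0)) :
    Tendsto (fun n => Qform R (f n) (f n)) atTop (nhds 0) := by
  have hden : ∀ t ∈ Set.Icc (0:ℝ) T, ∃ g : ℝ → ℝ, Integrable g ∧
      (∀ u ∉ Set.Icc 0 T, g u = 0) ∧ ∀ s ∈ Set.Icc 0 T,
      R s t = ∫ u, Set.indicator (Set.Ico 0 s) (fun _ => (1:ℝ)) u * g u := by
    intro t ht
    rcases ht.1.eq_or_lt with rfl | h0
    · refine ⟨0, integrable_zero _ _ _, fun _ _ => rfl, fun s hs => ?_⟩
      simpa [hsymm s 0] using hzero s hs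
    · exact exists_integrable_density hH0 (r := fun x => R x t) (d := fun s => D s t)
        (hcont.comp (Continuous.prodMk_left t).continuousOn fun s hs => ⟨hs, ht⟩)
        (hzero t ht) (fun s hs hne => hD t ⟨h0, ht.2⟩ s hs hne) hC
  have hweak : ∀ k, Tendsto (fun n => Qform R (f n) (f k)) atTop (nhds 0) := by
    intro k
    simp_rw [Qform_comm hsymm _ (f k)]
    have hterm : ∀ t ∈ (f k).support, Tendsto (fun n => (f n).sum fun t' b =>
        f k t * b * ∏ i, R (t i) (t' i)) atTop (nhds 0) := by
      intro t ht
      choose g hg hg0 hgR using fun i => hden (t i) (hsupp k t ht i)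
      have h := (tendsto_integral_elemFun_mul_prod hg hg0 f hbdd hae).const_mul (f k t)
      rw [mul_zero] at h
      refine h.congr fun n => ?_
      rw [← sum_mul_prod_eq_integral hg hgR (f n) (hsupp n), Finsupp.mul_sum]
      simp only [mul_assoc, hsymm]
    simpa [Qform, Finsupp.sum] using tendsto_finsetSum _ hterm
  rw [Metric.tendsto_atTop]
  intro ε hε
  obtain ⟨⟨N, N'⟩, hN⟩ := Metric.tendsto_atTop.1 hcauchy (ε / 2) (by positivity)
  set k := max N N'
  obtain ⟨N₂, hN₂⟩ := Metric.tendsto_atTop.1 (hweak k) (ε / 4) (by positivity)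
  refine ⟨max k N₂, fun n hn => ?_⟩
  have h1 := hN (n, k) ⟨(le_max_left _ _).trans ((le_max_left _ _).trans hn), le_max_right _ _⟩
  have h2 := hN₂ n ((le_max_right _ _).trans hn)
  have hn0 := Qform_self_nonneg hsymm hpsd (f n) (hsupp n)
  have hk0 := Qform_self_nonneg hsymm hpsd (f k) (hsupp k)
  simp only [Real.dist_eq, sub_zero] at h1 h2 ⊢
  rw [Qform_sub_self hsymm] at h1
  rw [abs_of_nonneg hn0]
  have h3 := (abs_lt.1 h1).2
  have h4 := (abs_lt.1 h2).2
  linarith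
end

section
/- For every H ∈ (1/4, 1) with H ≠ 1/2, the integral ∫_{0<u<v<w<1} (w−u)^{2H−2}(v−u)^{2H−1} du dv dw is finite and equals 1/(8H²(4H−1)). -/
open MeasureTheory

/-- The lower Lebesgue integral of `(x - a) ^ r` over `(a, b)`. -/
theorem lintegral_Ioo_sub_left_rpow {a b r : ℝ} (hab : a ≤ b) (hr : -1 < r) :
    ∫⁻ x in Set.Ioo a b, ENNReal.ofReal ((x - a) ^ r)
      = ENNReal.ofReal ((b - a) ^ (r + 1) / (r + 1)) := by
  have hint : IntervalIntegrable (fun x : ℝ => (x - a) ^ r) volume a b := by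
    have h := (intervalIntegral.intervalIntegrable_rpow' (a := 0) (b := b - a) hr).comp_sub_right a
    simpa using h
  rw [intervalIntegrable_iff_integrableOn_Ioo_of_le hab] at hint
  rw [← ofReal_integral_eq_lintegral_ofReal hint, ← integral_Ioc_eq_integral_Ioo,
    ← intervalIntegral.integral_of_le hab,
    intervalIntegral.integral_comp_sub_right (fun x => x ^ r) a, integral_rpow (Or.inl hr),
    sub_self, Real.zero_rpow (by linarith), sub_zero]
  filter_upwards [ae_restrict_mem measurableSet_Ioo] with x hx
  exact Real.rpow_nonneg (by linarith [hx.1]) _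

/-- The lower Lebesgue integral of `(b - x) ^ r` over `(a, b)`. -/
theorem lintegral_Ioo_sub_right_rpow {a b r : ℝ} (hab : a ≤ b) (hr : -1 < r) :
    ∫⁻ x in Set.Ioo a b, ENNReal.ofReal ((b - x) ^ r)
      = ENNReal.ofReal ((b - a) ^ (r + 1) / (r + 1)) := by
  have h := (Measure.measurePreserving_neg (volume : Measure ℝ)).setLIntegral_comp_preimage_emb
    (MeasurableEquiv.neg ℝ).measurableEmbedding
    (fun x => ENNReal.ofReal ((x - -b) ^ r)) (Set.Ioo (-b) (-a))
  have hs : (Neg.neg : ℝ → ℝ) ⁻¹' Set.Ioo (-b) (-a) = Set.Ioo a b := by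
    ext x; simp
  rw [hs, lintegral_Ioo_sub_left_rpow (neg_le_neg hab) hr] at h
  simpa [neg_add_eq_sub] using h

/-- Iterated form of the lower Lebesgue integral over the open simplex, the middle variable being
integrated first. -/
theorem setLIntegral_simplex {f : ℝ × ℝ × ℝ → ENNReal} (hf : Measurable f) :
    ∫⁻ p in {p : ℝ × ℝ × ℝ | 0 < p.1 ∧ p.1 < p.2.1 ∧ p.2.1 < p.2.2 ∧ p.2.2 < 1}, f p
      = ∫⁻ u in Set.Ioo (0 : ℝ) 1, ∫⁻ w in Set.Ioo u 1, ∫⁻ v in Set.Ioo u w, f (u, v, w) := by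
  set S := {p : ℝ × ℝ × ℝ | 0 < p.1 ∧ p.1 < p.2.1 ∧ p.2.1 < p.2.2 ∧ p.2.2 < 1} with hS_def
  have hS : MeasurableSet S := by
    rw [hS_def]
    measurability
  have hg : Measurable (S.indicator f) := hf.indicator hS
  rw [← lintegral_indicator hS, Measure.volume_eq_prod, lintegral_prod _ hg.aemeasurable,
    ← lintegral_indicator measurableSet_Ioo]
  refine lintegral_congr fun u => ?_
  rw [Measure.volume_eq_prod,
    lintegral_prod_symm (fun q => S.indicator f (u, q))
      (hg.comp measurable_prodMk_left).aemeasurable]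
  by_cases hu : u ∈ Set.Ioo (0 : ℝ) 1
  · rw [Set.indicator_of_mem hu, ← lintegral_indicator measurableSet_Ioo]
    refine lintegral_congr fun w => ?_
    by_cases hw : w ∈ Set.Ioo u 1
    · rw [Set.indicator_of_mem hw, ← lintegral_indicator measurableSet_Ioo]
      refine lintegral_congr fun v => ?_
      have : (u, v, w) ∈ S ↔ v ∈ Set.Ioo u w := by
        simp [hS_def, hu.1, hw.2]
      simp [Set.indicator, this]
    · rw [Set.indicator_of_notMem hw, lintegral_eq_zero_of_ae_eq_zero]
      refine .of_forall fun v => Set.indicator_of_notMem ?_ _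
      rintro ⟨-, h1, h2, h3⟩
      exact hw ⟨h1.trans h2, h3⟩
  · rw [Set.indicator_of_notMem hu, lintegral_eq_zero_of_ae_eq_zero]
    refine .of_forall fun w => lintegral_eq_zero_of_ae_eq_zero ?_
    refine .of_forall fun v => Set.indicator_of_notMem ?_ _
    rintro ⟨h0, h1, h2, h3⟩
    exact hu ⟨h0, h1.trans (h2.trans h3)⟩

theorem setLIntegral_simplex_rpow {H : ℝ} (hH : 1/4 < H) :
    ∫⁻ p in {p : ℝ × ℝ × ℝ | 0 < p.1 ∧ p.1 < p.2.1 ∧ p.2.1 < p.2.2 ∧ p.2.2 < 1},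
        ENNReal.ofReal ((p.2.2 - p.1) ^ (2*H - 2) * (p.2.1 - p.1) ^ (2*H - 1))
      = ENNReal.ofReal (1 / (8 * H ^ 2 * (4*H - 1))) := by
  have hv (u w : ℝ) (hw : w ∈ Set.Ioo u 1) :
      ∫⁻ v in Set.Ioo u w, ENNReal.ofReal ((w - u) ^ (2*H - 2) * (v - u) ^ (2*H - 1))
        = ENNReal.ofReal (1 / (2*H)) * ENNReal.ofReal ((w - u) ^ (4*H - 2)) := by
    have hpos : 0 < w - u := sub_pos.2 hw.1
    simp_rw [ENNReal.ofReal_mul (Real.rpow_nonneg hpos.le (2*H - 2))]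
    rw [lintegral_const_mul' _ _ ENNReal.ofReal_ne_top,
      lintegral_Ioo_sub_left_rpow hw.1.le (by linarith),
      ← ENNReal.ofReal_mul (by positivity), ← ENNReal.ofReal_mul (by positivity),
      sub_add_cancel, show 4*H - 2 = (2*H - 2) + 2*H by ring, Real.rpow_add hpos (2*H - 2)]
    congr 1
    ring
  have hw (u : ℝ) (hu : u ∈ Set.Ioo (0 : ℝ) 1) :
      ∫⁻ w in Set.Ioo u 1, ∫⁻ v in Set.Ioo u w,
          ENNReal.ofReal ((w - u) ^ (2*H - 2) * (v - u) ^ (2*H - 1))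
        = ENNReal.ofReal (1 / (2*H) / (4*H - 1)) * ENNReal.ofReal ((1 - u) ^ (4*H - 1)) := by
    have h4 : 0 < 4*H - 1 := by linarith
    rw [setLIntegral_congr_fun measurableSet_Ioo (hv u),
      lintegral_const_mul' _ _ ENNReal.ofReal_ne_top,
      lintegral_Ioo_sub_left_rpow hu.2.le (by linarith),
      ← ENNReal.ofReal_mul (by positivity), ← ENNReal.ofReal_mul (by positivity),
      show 4*H - 2 + 1 = 4*H - 1 by ring]
    congr 1
    ring
  have h4 : 0 < 4*H - 1 := by linarith
  rw [setLIntegral_simplex (by fun_prop), setLIntegral_congr_fun measurableSet_Ioo hw,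
    lintegral_const_mul' _ _ ENNReal.ofReal_ne_top,
    lintegral_Ioo_sub_right_rpow zero_le_one (by linarith),
    ← ENNReal.ofReal_mul (by positivity), sub_zero, Real.one_rpow, sub_add_cancel]
  congr 1
  field_simp
  norm_num

/-- For every `H ∈ (1/4, 1)` with `H ≠ 1/2`, the integral
`∫_{0<u<v<w<1} (w−u)^{2H−2}(v−u)^{2H−1} du dv dw` is finite and equals `1/(8H²(4H−1))`. -/
theorem stmt7 (H : ℝ) (hH : 1/4 < H) (hH1 : H < 1) (hH2 : H ≠ 1/2) :
    IntegrableOn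
      (fun p : ℝ × ℝ × ℝ => (p.2.2 - p.1) ^ (2*H - 2) * (p.2.1 - p.1) ^ (2*H - 1))
      {p : ℝ × ℝ × ℝ | 0 < p.1 ∧ p.1 < p.2.1 ∧ p.2.1 < p.2.2 ∧ p.2.2 < 1} ∧
    (∫ p in {p : ℝ × ℝ × ℝ | 0 < p.1 ∧ p.1 < p.2.1 ∧ p.2.1 < p.2.2 ∧ p.2.2 < 1},
        (p.2.2 - p.1) ^ (2*H - 2) * (p.2.1 - p.1) ^ (2*H - 1))
      = 1 / (8 * H ^ 2 * (4*H - 1)) := by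
  have hS : MeasurableSet
      {p : ℝ × ℝ × ℝ | 0 < p.1 ∧ p.1 < p.2.1 ∧ p.2.1 < p.2.2 ∧ p.2.2 < 1} := by
    measurability
  have hmeas : Measurable
      (fun p : ℝ × ℝ × ℝ => (p.2.2 - p.1) ^ (2*H - 2) * (p.2.1 - p.1) ^ (2*H - 1)) := by
    fun_prop
  have hnn : 0 ≤ᵐ[volume.restrict
      {p : ℝ × ℝ × ℝ | 0 < p.1 ∧ p.1 < p.2.1 ∧ p.2.1 < p.2.2 ∧ p.2.2 < 1}]
      (fun p : ℝ × ℝ × ℝ => (p.2.2 - p.1) ^ (2*H - 2) * (p.2.1 - p.1) ^ (2*H - 1)) := by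
    filter_upwards [ae_restrict_mem hS] with p hp
    obtain ⟨-, h1, h2, -⟩ := hp
    exact mul_nonneg (Real.rpow_nonneg (by linarith) _) (Real.rpow_nonneg (by linarith) _)
  have h4 : 0 < 4*H - 1 := by linarith
  constructor
  · refine ⟨hmeas.aestronglyMeasurable, ?_⟩
    rw [hasFiniteIntegral_iff_ofReal hnn, setLIntegral_simplex_rpow hH]
    exact ENNReal.ofReal_lt_top
  · rw [integral_eq_lintegral_of_nonneg_ae hnn hmeas.aestronglyMeasurable,
      setLIntegral_simplex_rpow hH, ENNReal.toReal_ofReal (by positivity)]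
end

section
/- For every H ∈ (1/4, 1) with H ≠ 1/2, the integral J := ∫_{0<u<v<w<z<1} (w−u)^{2H−2}(z−v)^{2H−2} du dv dw dz is finite and satisfies H²(2H−1)² J = H/(4(4H−1)) − (H/4) ∫₀¹ v^{2H−1}(1−v)^{2H−1} dv. -/
open MeasureTheory

theorem integrableOn_and_setIntegral_of_sections {α β : Type*} [MeasurableSpace α]
    [MeasurableSpace β] {μ : Measure α} {ν : Measure β} [SFinite μ] [SFinite ν]
    {S : Set (α × β)} {A : Set α} {s : α → Set β} {f : α × β → ℝ} {G : α → ℝ}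
    (hS : MeasurableSet S) (hA : MeasurableSet A) (hs : ∀ x ∈ A, MeasurableSet (s x))
    (hmem : ∀ x y, (x, y) ∈ S ↔ x ∈ A ∧ y ∈ s x) (hf : Measurable f)
    (hf0 : ∀ x ∈ A, ∀ y ∈ s x, 0 ≤ f (x, y))
    (hsec : ∀ x ∈ A, IntegrableOn (fun y => f (x, y)) (s x) ν ∧
      ∫ y in s x, f (x, y) ∂ν = G x)
    (hG : IntegrableOn G A μ) :
    IntegrableOn f S (μ.prod ν) ∧ ∫ p in S, f p ∂(μ.prod ν) = ∫ x in A, G x ∂μ := by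
  have hsection : ∀ x ∈ A, (fun y => S.indicator f (x, y)) =
      (s x).indicator (fun y => f (x, y)) := by
    intro x hx
    ext y
    by_cases hy : y ∈ s x
    · rw [Set.indicator_of_mem ((hmem x y).2 ⟨hx, hy⟩), Set.indicator_of_mem hy]
    · rw [Set.indicator_of_notMem (fun h => hy ((hmem x y).1 h).2), Set.indicator_of_notMem hy]
  have hsection' : ∀ x ∉ A, (fun y => S.indicator f (x, y)) = fun _ => 0 := by
    intro x hx
    ext y
    exact Set.indicator_of_notMem (fun h => hx ((hmem x y).1 h).1) _
  have h0 : ∀ p, 0 ≤ S.indicator f p :=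
    Set.indicator_nonneg fun p hp => hf0 p.1 ((hmem p.1 p.2).1 hp).1 p.2 ((hmem p.1 p.2).1 hp).2
  have hint : (fun x => ∫ y, S.indicator f (x, y) ∂ν) = A.indicator G := by
    ext x
    by_cases hx : x ∈ A
    · rw [hsection x hx, integral_indicator (hs x hx), Set.indicator_of_mem hx, (hsec x hx).2]
    · rw [hsection' x hx, Set.indicator_of_notMem hx, integral_zero]
  have hI : Integrable (S.indicator f) (μ.prod ν) := by
    rw [integrable_prod_iff (hf.indicator hS).aestronglyMeasurable]
    refine ⟨.of_forall fun x => ?_, ?_⟩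
    · by_cases hx : x ∈ A
      · rw [hsection x hx, integrable_indicator_iff (hs x hx)]
        exact (hsec x hx).1
      · rw [hsection' x hx]
        exact integrable_zero _ _ _
    · simp_rw [Real.norm_of_nonneg (h0 _)]
      rw [hint, integrable_indicator_iff hA]
      exact hG
  refine ⟨(integrable_indicator_iff hS).1 hI, ?_⟩
  rw [← integral_indicator hS, integral_prod _ hI, hint, integral_indicator hA]

theorem integrableOn_and_setIntegral_of_sections_swap {α β : Type*} [MeasurableSpace α]
    [MeasurableSpace β] {μ : Measure α} {ν : Measure β} [SFinite μ] [SFinite ν]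
    {S : Set (α × β)} {A : Set β} {s : β → Set α} {f : α × β → ℝ} {G : β → ℝ}
    (hS : MeasurableSet S) (hA : MeasurableSet A) (hs : ∀ y ∈ A, MeasurableSet (s y))
    (hmem : ∀ x y, (x, y) ∈ S ↔ y ∈ A ∧ x ∈ s y) (hf : Measurable f)
    (hf0 : ∀ y ∈ A, ∀ x ∈ s y, 0 ≤ f (x, y))
    (hsec : ∀ y ∈ A, IntegrableOn (fun x => f (x, y)) (s y) μ ∧
      ∫ x in s y, f (x, y) ∂μ = G y)
    (hG : IntegrableOn G A ν) :
    IntegrableOn f S (μ.prod ν) ∧ ∫ p in S, f p ∂(μ.prod ν) = ∫ y in A, G y ∂ν := by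
  have hswap : MeasurePreserving (Prod.swap : β × α → α × β) (ν.prod μ) (μ.prod ν) :=
    Measure.measurePreserving_swap
  have hemb : MeasurableEmbedding (Prod.swap : β × α → α × β) :=
    MeasurableEquiv.prodComm.measurableEmbedding
  rw [← hswap.integrableOn_comp_preimage hemb, ← hswap.setIntegral_preimage_emb hemb]
  exact integrableOn_and_setIntegral_of_sections (hS.preimage measurable_swap) hA hs
    (fun y x => hmem x y) (hf.comp measurable_swap) hf0 hsec hG

theorem setIntegral_Ioo_rpow_sub_right {p q c r : ℝ} (hpq : p ≤ q)
    (h : -1 < r ∨ r ≠ -1 ∧ c < p) :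
    IntegrableOn (fun x => (x - c) ^ r) (Set.Ioo p q) ∧
      ∫ x in Set.Ioo p q, (x - c) ^ r = ((q - c) ^ (r + 1) - (p - c) ^ (r + 1)) / (r + 1) := by
  have h' : -1 < r ∨ r ≠ -1 ∧ (0 : ℝ) ∉ Set.uIcc (p - c) (q - c) := by
    refine h.imp_right fun h => ⟨h.1, ?_⟩
    rw [Set.uIcc_of_le (by linarith)]
    exact fun h0 => by linarith [h0.1, h.2]
  constructor
  · rw [← intervalIntegrable_iff_integrableOn_Ioo_of_le hpq]
    have hi : IntervalIntegrable (fun x : ℝ => x ^ r) volume (p - c) (q - c) := by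
      rcases h' with h' | h'
      · exact intervalIntegral.intervalIntegrable_rpow' h'
      · exact intervalIntegral.intervalIntegrable_rpow (.inr h'.2)
    simpa using hi.comp_sub_right c
  · rw [← integral_Ioc_eq_integral_Ioo, ← intervalIntegral.integral_of_le hpq,
      intervalIntegral.integral_comp_sub_right (fun x => x ^ r), integral_rpow h']

theorem setIntegral_Ioo_rpow_sub_left {p q c r : ℝ} (hpq : p ≤ q)
    (h : -1 < r ∨ r ≠ -1 ∧ q < c) :
    IntegrableOn (fun x => (c - x) ^ r) (Set.Ioo p q) ∧
      ∫ x in Set.Ioo p q, (c - x) ^ r = ((c - p) ^ (r + 1) - (c - q) ^ (r + 1)) / (r + 1) := by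
  have h' : -1 < r ∨ r ≠ -1 ∧ (0 : ℝ) ∉ Set.uIcc (c - q) (c - p) := by
    refine h.imp_right fun h => ⟨h.1, ?_⟩
    rw [Set.uIcc_of_le (by linarith)]
    exact fun h0 => by linarith [h0.1, h.2]
  constructor
  · rw [← intervalIntegrable_iff_integrableOn_Ioo_of_le hpq]
    have hi : IntervalIntegrable (fun x : ℝ => x ^ r) volume (c - p) (c - q) := by
      rcases h' with h' | h'
      · exact intervalIntegral.intervalIntegrable_rpow' h'
      · exact (intervalIntegral.intervalIntegrable_rpow (.inr h'.2)).symm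
    simpa using hi.comp_sub_left c
  · rw [← integral_Ioc_eq_integral_Ioo, ← intervalIntegral.integral_of_le hpq,
      intervalIntegral.integral_comp_sub_left (fun x => x ^ r), integral_rpow h']

theorem integrableOn_rpow_mul_one_sub_rpow {a b : ℝ} (ha : -1 < a) (hb : -1 < b) :
    IntegrableOn (fun x : ℝ => x ^ a * (1 - x) ^ b) (Set.Ioo 0 1) := by
  have h := (Complex.betaIntegral_convergent (u := ((a + 1 : ℝ) : ℂ)) (v := ((b + 1 : ℝ) : ℂ))
    (by rw [Complex.ofReal_re]; linarith) (by rw [Complex.ofReal_re]; linarith))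
  rw [intervalIntegrable_iff_integrableOn_Ioc_of_le zero_le_one] at h
  refine (integrableOn_congr_fun (fun x hx => ?_) measurableSet_Ioo).1
    (h.mono_set Set.Ioo_subset_Ioc_self).norm
  have hx1 : 0 < 1 - x := sub_pos.2 hx.2
  have hcast : (1 : ℂ) - (x : ℂ) = ((1 - x : ℝ) : ℂ) := by push_cast; rfl
  simp only [norm_mul]
  rw [hcast, Complex.norm_cpow_eq_rpow_re_of_pos hx.1, Complex.norm_cpow_eq_rpow_re_of_pos hx1]
  simp

theorem setIntegral_rpow_mul_one_sub_rpow_add_one {a : ℝ} (ha : -1 < a) :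
    ∫ x in Set.Ioo (0 : ℝ) 1, x ^ a * (1 - x) ^ (a + 1) =
      (∫ x in Set.Ioo (0 : ℝ) 1, x ^ a * (1 - x) ^ a) / 2 := by
  have hsymm : ∫ x in Set.Ioo (0 : ℝ) 1, x ^ a * (1 - x) ^ (a + 1) =
      ∫ x in Set.Ioo (0 : ℝ) 1, x ^ (a + 1) * (1 - x) ^ a := by
    simp_rw [← integral_Ioc_eq_integral_Ioo, ← intervalIntegral.integral_of_le zero_le_one]
    have h := intervalIntegral.integral_comp_sub_left (a := 0) (b := 1)
      (fun x : ℝ => x ^ (a + 1) * (1 - x) ^ a) 1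
    simp only [sub_sub_cancel, sub_self, sub_zero] at h
    rw [← h]
    exact intervalIntegral.integral_congr fun x _ => mul_comm _ _
  have hadd : (∫ x in Set.Ioo (0 : ℝ) 1, x ^ a * (1 - x) ^ (a + 1)) +
      (∫ x in Set.Ioo (0 : ℝ) 1, x ^ (a + 1) * (1 - x) ^ a) =
      ∫ x in Set.Ioo (0 : ℝ) 1, x ^ a * (1 - x) ^ a := by
    rw [← integral_add (integrableOn_rpow_mul_one_sub_rpow ha (by linarith))
      (integrableOn_rpow_mul_one_sub_rpow (by linarith) ha)]
    refine setIntegral_congr_fun measurableSet_Ioo fun x hx => ?_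
    have hx1 : 0 < 1 - x := sub_pos.2 hx.2
    simp only [Real.rpow_add_one hx.1.ne', Real.rpow_add_one hx1.ne']
    ring
  linarith

/-- The open triangle `0 < v < w < 1`. -/
def openTriangle : Set (ℝ × ℝ) := {p | 0 < p.1 ∧ p.1 < p.2 ∧ p.2 < 1}

theorem measurableSet_openTriangle : MeasurableSet openTriangle :=
  (measurableSet_lt measurable_const measurable_fst).inter
    ((measurableSet_lt measurable_fst measurable_snd).inter
      (measurableSet_lt measurable_snd measurable_const))

theorem setIntegral_openTriangle_of_sections_fst {f : ℝ × ℝ → ℝ} {G : ℝ → ℝ} (hf : Measurable f)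
    (hf0 : ∀ p ∈ openTriangle, 0 ≤ f p)
    (hsec : ∀ v ∈ Set.Ioo (0 : ℝ) 1, IntegrableOn (fun w => f (v, w)) (Set.Ioo v 1) ∧
      ∫ w in Set.Ioo v 1, f (v, w) = G v)
    (hG : IntegrableOn G (Set.Ioo 0 1)) :
    IntegrableOn f openTriangle ∧ ∫ p in openTriangle, f p = ∫ v in Set.Ioo 0 1, G v :=
  integrableOn_and_setIntegral_of_sections measurableSet_openTriangle measurableSet_Ioo
    (fun _ _ => measurableSet_Ioo)
    (fun _ _ => ⟨fun h => ⟨⟨h.1, h.2.1.trans h.2.2⟩, h.2⟩, fun h => ⟨h.1.1, h.2⟩⟩) hf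
    (fun v hv w hw => hf0 (v, w) ⟨hv.1, hw⟩) hsec hG

theorem setIntegral_openTriangle_of_sections_snd {f : ℝ × ℝ → ℝ} {G : ℝ → ℝ} (hf : Measurable f)
    (hf0 : ∀ p ∈ openTriangle, 0 ≤ f p)
    (hsec : ∀ w ∈ Set.Ioo (0 : ℝ) 1, IntegrableOn (fun v => f (v, w)) (Set.Ioo 0 w) ∧
      ∫ v in Set.Ioo 0 w, f (v, w) = G w)
    (hG : IntegrableOn G (Set.Ioo 0 1)) :
    IntegrableOn f openTriangle ∧ ∫ p in openTriangle, f p = ∫ w in Set.Ioo 0 1, G w :=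
  integrableOn_and_setIntegral_of_sections_swap measurableSet_openTriangle measurableSet_Ioo
    (fun _ _ => measurableSet_Ioo)
    (fun _ _ => ⟨fun h => ⟨⟨h.1.trans h.2.1, h.2.2⟩, h.1, h.2.1⟩,
      fun h => ⟨h.2.1, h.2.2, h.1.2⟩⟩) hf
    (fun w hw v hv => hf0 (v, w) ⟨hv.1, hv.2, hw.2⟩) hsec hG

theorem setIntegral_Ioo_rpow {r : ℝ} (hr : -1 < r) :
    IntegrableOn (fun x : ℝ => x ^ r) (Set.Ioo 0 1) ∧
      ∫ x in Set.Ioo (0 : ℝ) 1, x ^ r = 1 / (r + 1) := by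
  have h := setIntegral_Ioo_rpow_sub_right (c := 0) zero_le_one (.inl hr)
  have hr1 : r + 1 ≠ 0 := by linarith
  simpa [Real.zero_rpow hr1] using h

theorem setIntegral_Ioo_one_sub_rpow {r : ℝ} (hr : -1 < r) :
    IntegrableOn (fun x : ℝ => (1 - x) ^ r) (Set.Ioo 0 1) ∧
      ∫ x in Set.Ioo (0 : ℝ) 1, (1 - x) ^ r = 1 / (r + 1) := by
  have h := setIntegral_Ioo_rpow_sub_left (c := 1) zero_le_one (.inl hr)
  have hr1 : r + 1 ≠ 0 := by linarith
  simpa [Real.zero_rpow hr1] using h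

theorem setIntegral_openTriangle_snd_rpow_mul_sub_rpow {s r : ℝ} (hs : -1 < s + (r + 1))
    (hr : -1 < r) :
    IntegrableOn (fun p : ℝ × ℝ => p.2 ^ s * (p.2 - p.1) ^ r) openTriangle ∧
      ∫ p in openTriangle, p.2 ^ s * (p.2 - p.1) ^ r = 1 / ((r + 1) * (s + r + 2)) := by
  obtain ⟨hi, he⟩ := setIntegral_Ioo_rpow hs
  have h := setIntegral_openTriangle_of_sections_snd
    (f := fun p => p.2 ^ s * (p.2 - p.1) ^ r) (G := fun w => w ^ (s + (r + 1)) / (r + 1))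
    (by fun_prop)
    (fun p hp => mul_nonneg (Real.rpow_nonneg (hp.1.trans hp.2.1).le _)
      (Real.rpow_nonneg (sub_pos.2 hp.2.1).le _))
    (fun w hw => by
      obtain ⟨hi, he⟩ := setIntegral_Ioo_rpow_sub_left (c := w) hw.1.le (.inl hr)
      refine ⟨hi.const_mul (w ^ s), (integral_const_mul (w ^ s) fun v => (w - v) ^ r).trans ?_⟩
      rw [he, sub_self, Real.zero_rpow (by linarith), Real.rpow_add hw.1]
      simp only [sub_zero, mul_div_assoc])
    (hi.div_const _)
  refine ⟨h.1, h.2.trans ?_⟩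
  rw [integral_div, he, div_div]
  congr 1
  ring

theorem setIntegral_openTriangle_sub_rpow_mul_one_sub_rpow {s r : ℝ} (hs : -1 < s + (r + 1))
    (hr : -1 < r) :
    IntegrableOn (fun p : ℝ × ℝ => (p.2 - p.1) ^ r * (1 - p.1) ^ s) openTriangle ∧
      ∫ p in openTriangle, (p.2 - p.1) ^ r * (1 - p.1) ^ s = 1 / ((r + 1) * (s + r + 2)) := by
  obtain ⟨hi, he⟩ := setIntegral_Ioo_one_sub_rpow hs
  have h := setIntegral_openTriangle_of_sections_fst
    (f := fun p => (p.2 - p.1) ^ r * (1 - p.1) ^ s)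
    (G := fun v => (1 - v) ^ (s + (r + 1)) / (r + 1))
    (by fun_prop)
    (fun p hp => mul_nonneg (Real.rpow_nonneg (sub_pos.2 hp.2.1).le _)
      (Real.rpow_nonneg (sub_pos.2 (hp.2.1.trans hp.2.2)).le _))
    (fun v hv => by
      obtain ⟨hi, he⟩ := setIntegral_Ioo_rpow_sub_right (c := v) hv.2.le (.inl hr)
      refine ⟨hi.mul_const ((1 - v) ^ s),
        (integral_mul_const ((1 - v) ^ s) fun w => (w - v) ^ r).trans ?_⟩
      rw [he, sub_self, Real.zero_rpow (by linarith),
        Real.rpow_add (sub_pos.2 hv.2) s, sub_zero, div_mul_eq_mul_div, mul_comm])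
    (hi.div_const _)
  refine ⟨h.1, h.2.trans ?_⟩
  rw [integral_div, he, div_div]
  congr 1
  ring

theorem setIntegral_openTriangle_snd_rpow_mul_one_sub_rpow {a : ℝ} (ha : -1 < a) :
    IntegrableOn (fun p : ℝ × ℝ => p.2 ^ a * (1 - p.1) ^ a) openTriangle ∧
      ∫ p in openTriangle, p.2 ^ a * (1 - p.1) ^ a =
        1 / (a + 1) ^ 2 - (∫ x in Set.Ioo (0 : ℝ) 1, x ^ a * (1 - x) ^ a) / (2 * (a + 1)) := by
  obtain ⟨hi, he⟩ := setIntegral_Ioo_rpow ha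
  have hb := integrableOn_rpow_mul_one_sub_rpow ha (b := a + 1) (by linarith)
  have h := setIntegral_openTriangle_of_sections_snd
    (f := fun p => p.2 ^ a * (1 - p.1) ^ a)
    (G := fun w => (w ^ a - w ^ a * (1 - w) ^ (a + 1)) / (a + 1))
    (by fun_prop)
    (fun p hp => mul_nonneg (Real.rpow_nonneg (hp.1.trans hp.2.1).le _)
      (Real.rpow_nonneg (sub_pos.2 (hp.2.1.trans hp.2.2)).le _))
    (fun w hw => by
      obtain ⟨hi, he⟩ := setIntegral_Ioo_rpow_sub_left (c := 1) hw.1.le (.inl ha)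
      refine ⟨hi.const_mul (w ^ a), (integral_const_mul (w ^ a) fun v => (1 - v) ^ a).trans ?_⟩
      rw [he, sub_zero, Real.one_rpow]
      ring)
    ((hi.sub hb).div_const _)
  refine ⟨h.1, h.2.trans ?_⟩
  rw [integral_div, integral_sub hi hb, he, setIntegral_rpow_mul_one_sub_rpow_add_one ha]
  have ha1 : a + 1 ≠ 0 := by linarith
  field_simp

theorem setIntegral_openTriangle_sub_mul_sub {a : ℝ} (ha : -1 / 2 < a) :
    IntegrableOn (fun p : ℝ × ℝ => (p.2 ^ a - (p.2 - p.1) ^ a) * ((1 - p.1) ^ a - (p.2 - p.1) ^ a))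
      openTriangle ∧
    ∫ p in openTriangle, (p.2 ^ a - (p.2 - p.1) ^ a) * ((1 - p.1) ^ a - (p.2 - p.1) ^ a) =
      1 / (2 * (a + 1) * (2 * a + 1)) -
        (∫ x in Set.Ioo (0 : ℝ) 1, x ^ a * (1 - x) ^ a) / (2 * (a + 1)) := by
  obtain ⟨hi₁, he₁⟩ := setIntegral_openTriangle_snd_rpow_mul_one_sub_rpow (a := a) (by linarith)
  obtain ⟨hi₂, he₂⟩ := setIntegral_openTriangle_snd_rpow_mul_sub_rpow (s := a) (r := a)
    (by linarith) (by linarith)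
  obtain ⟨hi₃, he₃⟩ := setIntegral_openTriangle_sub_rpow_mul_one_sub_rpow (s := a) (r := a)
    (by linarith) (by linarith)
  obtain ⟨hi₄, he₄⟩ := setIntegral_openTriangle_snd_rpow_mul_sub_rpow (s := 0) (r := 2 * a)
    (by linarith) (by linarith)
  have hexpand : Set.EqOn (fun p : ℝ × ℝ => p.2 ^ a * (1 - p.1) ^ a -
      p.2 ^ a * (p.2 - p.1) ^ a - (p.2 - p.1) ^ a * (1 - p.1) ^ a +
        p.2 ^ (0 : ℝ) * (p.2 - p.1) ^ (2 * a))
      (fun p => (p.2 ^ a - (p.2 - p.1) ^ a) * ((1 - p.1) ^ a - (p.2 - p.1) ^ a))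
      openTriangle := by
    intro p hp
    simp only [Real.rpow_zero, two_mul, Real.rpow_add (sub_pos.2 hp.2.1)]
    ring
  refine ⟨(integrableOn_congr_fun hexpand measurableSet_openTriangle).1
    (((hi₁.sub hi₂).sub hi₃).add hi₄), ?_⟩
  rw [← setIntegral_congr_fun measurableSet_openTriangle hexpand]
  refine (integral_add ((hi₁.sub hi₂).sub hi₃) hi₄).trans ?_
  rw [integral_sub' (hi₁.sub hi₂) hi₃, integral_sub' hi₁ hi₂, he₁, he₂, he₃, he₄]
  have h₁ : a + 1 ≠ 0 := by linarith
  have h₂ : 2 * a + 1 ≠ 0 := by linarith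
  rw [show a + a + 2 = 2 * (a + 1) by ring, show 0 + 2 * a + 2 = 2 * (a + 1) by ring]
  field_simp
  ring

theorem setIntegral_openSimplex_rpow {a : ℝ} (ha : -1 / 2 < a) (ha0 : a ≠ 0) :
    IntegrableOn
      (fun p : ℝ × ℝ × ℝ × ℝ => (p.2.2.1 - p.1) ^ (a - 1) * (p.2.2.2 - p.2.1) ^ (a - 1))
      {p : ℝ × ℝ × ℝ × ℝ |
        0 < p.1 ∧ p.1 < p.2.1 ∧ p.2.1 < p.2.2.1 ∧ p.2.2.1 < p.2.2.2 ∧ p.2.2.2 < 1} ∧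
    ∫ p in {p : ℝ × ℝ × ℝ × ℝ |
        0 < p.1 ∧ p.1 < p.2.1 ∧ p.2.1 < p.2.2.1 ∧ p.2.2.1 < p.2.2.2 ∧ p.2.2.2 < 1},
      (p.2.2.1 - p.1) ^ (a - 1) * (p.2.2.2 - p.2.1) ^ (a - 1) =
      (1 / (2 * (a + 1) * (2 * a + 1)) -
        (∫ x in Set.Ioo (0 : ℝ) 1, x ^ a * (1 - x) ^ a) / (2 * (a + 1))) / a ^ 2 := by
  have hexp : a - 1 ≠ -1 := fun h => ha0 (by linarith)
  have hright : ∀ {v w : ℝ}, v < w → w < 1 →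
      IntegrableOn (fun z => (z - v) ^ (a - 1)) (Set.Ioo w 1) ∧
      ∫ z in Set.Ioo w 1, (z - v) ^ (a - 1) = ((1 - v) ^ a - (w - v) ^ a) / a := fun hvw hw => by
    simpa using setIntegral_Ioo_rpow_sub_right hw.le (.inr ⟨hexp, hvw⟩)
  have hleft : ∀ {v w : ℝ}, 0 < v → v < w →
      IntegrableOn (fun u => (w - u) ^ (a - 1)) (Set.Ioo 0 v) ∧
      ∫ u in Set.Ioo 0 v, (w - u) ^ (a - 1) = (w ^ a - (w - v) ^ a) / a := fun hv hvw => by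
    simpa using setIntegral_Ioo_rpow_sub_left hv.le (.inr ⟨hexp, hvw⟩)
  have hleft_nonneg : ∀ {v w : ℝ}, 0 < v → v < w → 0 ≤ (w ^ a - (w - v) ^ a) / a :=
    fun {v w} hv hvw => by
      rw [← (hleft hv hvw).2]
      exact setIntegral_nonneg measurableSet_Ioo fun u hu =>
        Real.rpow_nonneg (by linarith [hu.2]) _
  obtain ⟨hi, he⟩ := setIntegral_openTriangle_sub_mul_sub ha
  have hassoc : MeasurePreserving (MeasurableEquiv.prodAssoc : (ℝ × ℝ) × ℝ ≃ᵐ ℝ × ℝ × ℝ) :=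
    volume_preserving_prodAssoc
  let S : Set (ℝ × ℝ × ℝ) := {q | 0 < q.1 ∧ q.1 < q.2.1 ∧ q.2.1 < q.2.2 ∧ q.2.2 < 1}
  let g : ℝ × ℝ × ℝ → ℝ := fun q =>
    (q.2.1 ^ a - (q.2.1 - q.1) ^ a) / a * (q.2.2 - q.1) ^ (a - 1)
  have hS : MeasurableSet S := by
    measurability
  have hg : Measurable g := by fun_prop
  have h3 : IntegrableOn g S ∧ ∫ q in S, g q = ∫ p in openTriangle,
      (p.2 ^ a - (p.2 - p.1) ^ a) * ((1 - p.1) ^ a - (p.2 - p.1) ^ a) / a ^ 2 := by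
    rw [← hassoc.integrableOn_comp_preimage MeasurableEquiv.prodAssoc.measurableEmbedding,
      ← hassoc.setIntegral_preimage_emb MeasurableEquiv.prodAssoc.measurableEmbedding]
    refine integrableOn_and_setIntegral_of_sections (s := fun p : ℝ × ℝ => Set.Ioo p.2 1)
      (hS.preimage MeasurableEquiv.prodAssoc.measurable) measurableSet_openTriangle
      (fun _ _ => measurableSet_Ioo)
      (fun _ _ => ⟨fun h => ⟨⟨h.1, h.2.1, h.2.2.1.trans h.2.2.2⟩, h.2.2⟩,
        fun h => ⟨h.1.1, h.1.2.1, h.2⟩⟩)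
      (hg.comp MeasurableEquiv.prodAssoc.measurable)
      (fun p hp z hz => mul_nonneg (hleft_nonneg hp.1 hp.2.1)
        (Real.rpow_nonneg (sub_pos.2 (hp.2.1.trans hz.1)).le _))
      (fun p hp => ?_) (hi.div_const _)
    obtain ⟨hi', he'⟩ := hright hp.2.1 hp.2.2
    refine ⟨hi'.const_mul ((p.2 ^ a - (p.2 - p.1) ^ a) / a),
      (integral_const_mul ((p.2 ^ a - (p.2 - p.1) ^ a) / a) fun z => (z - p.1) ^ (a - 1)).trans ?_⟩
    rw [he']
    ring
  have h4 := integrableOn_and_setIntegral_of_sections_swap (μ := (volume : Measure ℝ))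
    (ν := (volume : Measure (ℝ × ℝ × ℝ)))
    (S := {p : ℝ × ℝ × ℝ × ℝ |
        0 < p.1 ∧ p.1 < p.2.1 ∧ p.2.1 < p.2.2.1 ∧ p.2.2.1 < p.2.2.2 ∧ p.2.2.2 < 1})
    (A := S) (s := fun q => Set.Ioo 0 q.1) (G := g)
    (f := fun p => (p.2.2.1 - p.1) ^ (a - 1) * (p.2.2.2 - p.2.1) ^ (a - 1))
    (by measurability) hS (fun _ _ => measurableSet_Ioo)
    (fun _ _ => ⟨fun h => ⟨⟨h.1.trans h.2.1, h.2.2⟩, h.1, h.2.1⟩,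
      fun h => ⟨h.2.1, h.2.2, h.1.2⟩⟩)
    (by fun_prop)
    (fun q hq u hu => mul_nonneg
      (Real.rpow_nonneg (sub_pos.2 (hu.2.trans hq.2.1)).le _)
      (Real.rpow_nonneg (sub_pos.2 (hq.2.1.trans hq.2.2.1)).le _))
    (fun q hq => by
      obtain ⟨hi', he'⟩ := hleft hq.1 hq.2.1
      refine ⟨hi'.mul_const ((q.2.2 - q.1) ^ (a - 1)),
        (integral_mul_const ((q.2.2 - q.1) ^ (a - 1)) fun u => (q.2.1 - u) ^ (a - 1)).trans ?_⟩
      rw [he'])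
    h3.1
  refine ⟨h4.1, h4.2.trans (h3.2.trans ?_)⟩
  rw [integral_div, he]


/-- For every `H ∈ (1/4, 1)` with `H ≠ 1/2`, the integral
`J := ∫_{0<u<v<w<z<1} (w−u)^{2H−2}(z−v)^{2H−2}` is finite and satisfies
`H²(2H−1)² J = H/(4(4H−1)) − (H/4) ∫₀¹ v^{2H−1}(1−v)^{2H−1} dv`. -/
theorem stmt8 (H : ℝ) (hH : 1/4 < H) (hH1 : H < 1) (hH2 : H ≠ 1/2) :
    IntegrableOn
      (fun p : ℝ × ℝ × ℝ × ℝ =>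
        (p.2.2.1 - p.1) ^ (2*H - 2) * (p.2.2.2 - p.2.1) ^ (2*H - 2))
      {p : ℝ × ℝ × ℝ × ℝ |
        0 < p.1 ∧ p.1 < p.2.1 ∧ p.2.1 < p.2.2.1 ∧ p.2.2.1 < p.2.2.2 ∧ p.2.2.2 < 1} ∧
    H ^ 2 * (2*H - 1) ^ 2 *
      (∫ p in {p : ℝ × ℝ × ℝ × ℝ |
          0 < p.1 ∧ p.1 < p.2.1 ∧ p.2.1 < p.2.2.1 ∧ p.2.2.1 < p.2.2.2 ∧ p.2.2.2 < 1},
        (p.2.2.1 - p.1) ^ (2*H - 2) * (p.2.2.2 - p.2.1) ^ (2*H - 2))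
      = H / (4 * (4*H - 1)) - H/4 * ∫ v in Set.Ioo (0:ℝ) 1, v ^ (2*H - 1) * (1 - v) ^ (2*H - 1) := by
  have ha0 : 2 * H - 1 ≠ 0 := fun h => hH2 (by linarith)
  obtain ⟨hi, he⟩ := setIntegral_openSimplex_rpow (a := 2 * H - 1) (by linarith) ha0
  rw [show 2 * H - 1 - 1 = 2 * H - 2 by ring] at hi he
  refine ⟨hi, ?_⟩
  rw [he, show 2 * (2 * H - 1) + 1 = 4 * H - 1 by ring, show 2 * H - 1 + 1 = 2 * H by ring]
  have h₁ : H ≠ 0 := by linarith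
  have h₂ : H * 4 - 1 ≠ 0 := by linarith
  have h₃ : H * 2 - 1 ≠ 0 := by rwa [mul_comm]
  generalize (∫ x in Set.Ioo (0 : ℝ) 1, x ^ (2 * H - 1) * (1 - x) ^ (2 * H - 1)) = B
  field_simp
  ring
end

section
/- Let H ∈ (0,1) with H ≠ 1/2 and let 0 ≤ s < u < v. Then ∫_s^u ∫_u^v (z−w)^{2H−2} dz dw = [(v−s)^{2H} − (v−u)^{2H} − (u−s)^{2H}] / (2H(2H−1)). -/
open MeasureTheory

lemma integral_Ioo_sub_rpow {r w u v : ℝ} (hr : r ≠ -1) (hwu : w < u) (huv : u ≤ v) :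
    ∫ z in Set.Ioo u v, (z - w) ^ r = ((v - w) ^ (r + 1) - (u - w) ^ (r + 1)) / (r + 1) := by
  rw [← integral_Ioc_eq_integral_Ioo, ← intervalIntegral.integral_of_le huv,
    intervalIntegral.integral_comp_sub_right (fun x => x ^ r) w, integral_rpow]
  refine Or.inr ⟨hr, fun h => ?_⟩
  rw [Set.uIcc_of_le (by linarith)] at h
  linarith [h.1]

lemma integrableOn_Ioo_sub_rpow {r w u v : ℝ} (hwu : w < u) :
    IntegrableOn (fun z => (z - w) ^ r) (Set.Ioo u v) := by
  refine (ContinuousOn.integrableOn_Icc fun z hz => ?_).mono_set Set.Ioo_subset_Icc_self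
  exact ((continuousAt_id.sub continuousAt_const).rpow_const
    (Or.inl (sub_pos.2 (hwu.trans_le hz.1)).ne')).continuousWithinAt

lemma intervalIntegrable_const_sub_rpow {r : ℝ} (hr : -1 < r) (c s u : ℝ) :
    IntervalIntegrable (fun w => (c - w) ^ r) volume s u := by
  simpa using (intervalIntegral.intervalIntegrable_rpow' hr
    (a := c - s) (b := c - u)).comp_sub_left c

lemma integral_const_sub_rpow {r : ℝ} (hr : -1 < r) (c s u : ℝ) :
    ∫ w in s..u, (c - w) ^ r = ((c - s) ^ (r + 1) - (c - u) ^ (r + 1)) / (r + 1) := by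
  rw [intervalIntegral.integral_comp_sub_left (fun x => x ^ r) c, integral_rpow (Or.inl hr)]

lemma integrableOn_Ioo_prod_sub_rpow {r s u v : ℝ} (hr : -2 < r) (hr1 : r ≠ -1)
    (huv : u ≤ v) :
    IntegrableOn (fun p : ℝ × ℝ => (p.2 - p.1) ^ r) (Set.Ioo s u ×ˢ Set.Ioo u v)
      (volume.prod volume) := by
  rw [IntegrableOn, ← Measure.prod_restrict, integrable_prod_iff
    (by fun_prop : Measurable fun p : ℝ × ℝ => (p.2 - p.1) ^ r).aestronglyMeasurable]
  refine ⟨(ae_restrict_mem measurableSet_Ioo).mono fun w hw =>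
    integrableOn_Ioo_sub_rpow hw.2, ?_⟩
  have h (c : ℝ) := (intervalIntegrable_const_sub_rpow (by linarith : -1 < r + 1) c s u)
  have key := (((h v).sub (h u)).div_const (r + 1)).1.mono_set Set.Ioo_subset_Ioc_self
  refine Integrable.congr key ((ae_restrict_mem measurableSet_Ioo).mono fun w hw => ?_)
  simp only
  rw [← integral_Ioo_sub_rpow hr1 hw.2 huv]
  refine setIntegral_congr_fun measurableSet_Ioo fun z hz => ?_
  exact (Real.norm_of_nonneg (Real.rpow_nonneg (by linarith [hz.1, hw.2]) r)).symm

/-- Let `H ∈ (0,1)` with `H ≠ 1/2` and `0 ≤ s < u < v`. Then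
`∫_s^u ∫_u^v (z−w)^{2H−2} dz dw = [(v−s)^{2H} − (v−u)^{2H} − (u−s)^{2H}] / (2H(2H−1))`,
the double integral being the Lebesgue integral over the rectangle `(s,u) × (u,v)`. -/
theorem stmt10 (H : ℝ) (hH0 : 0 < H) (hH1 : H < 1) (hH2 : H ≠ 1/2)
    (s u v : ℝ) (hs : 0 ≤ s) (hsu : s < u) (huv : u < v) :
    (∫ p in Set.Ioo s u ×ˢ Set.Ioo u v, (p.2 - p.1) ^ (2*H - 2))
      = ((v - s) ^ (2*H) - (v - u) ^ (2*H) - (u - s) ^ (2*H)) / (2*H*(2*H - 1)) := by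
  have hr1 : 2 * H - 2 ≠ -1 := fun h => hH2 (by linarith)
  have hr : -1 < 2 * H - 1 := by linarith
  have h0 : 2 * H - 1 ≠ 0 := fun h => hr1 (by linarith)
  have e1 : 2 * H - 2 + 1 = 2 * H - 1 := by ring
  have e2 : 2 * H - 1 + 1 = 2 * H := by ring
  rw [Measure.volume_eq_prod, setIntegral_prod _
      (integrableOn_Ioo_prod_sub_rpow (by linarith) hr1 huv.le),
    setIntegral_congr_fun measurableSet_Ioo
      fun w hw => integral_Ioo_sub_rpow hr1 hw.2 huv.le,
    ← integral_Ioc_eq_integral_Ioo, ← intervalIntegral.integral_of_le hsu.le, e1,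
    intervalIntegral.integral_div, intervalIntegral.integral_sub
      (intervalIntegrable_const_sub_rpow hr v s u) (intervalIntegrable_const_sub_rpow hr u s u),
    integral_const_sub_rpow hr, integral_const_sub_rpow hr, e2, sub_self,
    Real.zero_rpow (by positivity)]
  field_simp
  ring
end

section
/- Let H ∈ (1/4, 1) with H ≠ 1/2. Then there exists a constant C = C(H) > 0 such that for all 0 ≤ s < t, ∫_{s<u<z<t} |(z−u)^{2H−1} − (z−s)^{2H−1}| · |(t−u)^{2H−1} − (z−u)^{2H−1}| du dz ≤ C (t−s)^{4H}. -/
open MeasureTheory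

/-- A function on the simplex `s < u < z < t` dominated by a function `h` of `z - u` has integral
at most `(t - s) * ∫_0^{t - s} h`. -/
theorem lintegral_simplex_le_of_le_sub {s t : ℝ} {F : ℝ × ℝ → ENNReal} {h : ℝ → ENNReal}
    (hh : Measurable h)
    (hF : ∀ u z : ℝ, s < u → u < z → z < t → F (u, z) ≤ h (z - u)) :
    ∫⁻ p : ℝ × ℝ, Set.indicator {p : ℝ × ℝ | s < p.1 ∧ p.1 < p.2 ∧ p.2 < t} F p
      ≤ ENNReal.ofReal (t - s) * ∫⁻ w in Set.Ioo 0 (t - s), h w := by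
  set k : ℝ → ENNReal := (Set.Ioo 0 (t - s)).indicator h
  have hk : Measurable k := hh.indicator measurableSet_Ioo
  set c : ℝ → ENNReal := (Set.Ioo s t).indicator 1
  have hc : Measurable c := measurable_one.indicator measurableSet_Ioo
  calc ∫⁻ p : ℝ × ℝ, Set.indicator {p : ℝ × ℝ | s < p.1 ∧ p.1 < p.2 ∧ p.2 < t} F p
      ≤ ∫⁻ p : ℝ × ℝ, c p.1 * k (p.2 - p.1) := by
        refine lintegral_mono fun p => Set.indicator_apply_le' (fun hq => ?_) fun _ => zero_le
        obtain ⟨u, z⟩ := p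
        obtain ⟨h1, h2, h3⟩ : s < u ∧ u < z ∧ z < t := hq
        have hu : u ∈ Set.Ioo s t := ⟨h1, h2.trans h3⟩
        have hw : z - u ∈ Set.Ioo 0 (t - s) := ⟨by linarith, by linarith⟩
        simpa [c, k, Set.indicator_of_mem hu, Set.indicator_of_mem hw] using hF u z h1 h2 h3
    _ = ∫⁻ u, ∫⁻ z, c u * k (z - u) := by
        rw [Measure.volume_eq_prod, lintegral_prod _ (by fun_prop)]
    _ = ∫⁻ u, c u * ∫⁻ w, k w := by
        refine lintegral_congr fun u => ?_
        rw [lintegral_const_mul _ (by fun_prop), lintegral_sub_right_eq_self k u]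
    _ = ENNReal.ofReal (t - s) * ∫⁻ w in Set.Ioo 0 (t - s), h w := by
        rw [lintegral_mul_const _ hc, lintegral_indicator_one measurableSet_Ioo, Real.volume_Ioo,
          lintegral_indicator measurableSet_Ioo]

theorem lintegral_Ioo_rpow {r L : ℝ} (hr : -1 < r) (hL : 0 ≤ L) :
    ∫⁻ w in Set.Ioo 0 L, ENNReal.ofReal (w ^ r) = ENNReal.ofReal (L ^ (r + 1) / (r + 1)) := by
  have hint := (intervalIntegral.intervalIntegrable_rpow' (a := 0) (b := L) hr).1
  have hnn : 0 ≤ᵐ[volume.restrict (Set.Ioc 0 L)] fun w : ℝ => w ^ r :=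
    (ae_restrict_iff' measurableSet_Ioc).2 (.of_forall fun w hw => Real.rpow_nonneg hw.1.le r)
  rw [Measure.restrict_congr_set Ioo_ae_eq_Ioc, ← ofReal_integral_eq_lintegral_ofReal hint hnn,
    ← intervalIntegral.integral_of_le hL, integral_rpow (Or.inl hr),
    Real.zero_rpow (by linarith), sub_zero]

theorem abs_sub_le_of_mem_Icc {x y M : ℝ} (hx : 0 ≤ x) (hxM : x ≤ M) (hy : 0 ≤ y) (hyM : y ≤ M) :
    |x - y| ≤ M := by
  rw [abs_le]
  constructor <;> linarith

/-- Let `H ∈ (1/4, 1)`, `H ≠ 1/2`. Then there is `C = C(H) > 0` such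
that for all `0 ≤ s < t`,
`∫_{s<u<z<t} |(z−u)^{2H−1} − (z−s)^{2H−1}| · |(t−u)^{2H−1} − (z−u)^{2H−1}| du dz ≤ C (t−s)^{4H}`,
finiteness of the integral being part of the claim (stated as an inequality in `ℝ≥0∞`). -/
theorem stmt17 (H : ℝ) (hH : 1/4 < H) (hH1 : H < 1) (hH2 : H ≠ 1/2) :
    ∃ C : ℝ, 0 < C ∧ ∀ s t : ℝ, 0 ≤ s → s < t →
      (∫⁻ p : ℝ × ℝ,
        Set.indicator {p : ℝ × ℝ | s < p.1 ∧ p.1 < p.2 ∧ p.2 < t}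
          (fun p => ENNReal.ofReal
            (|(p.2 - p.1) ^ (2*H - 1) - (p.2 - s) ^ (2*H - 1)| *
             |(t - p.1) ^ (2*H - 1) - (p.2 - p.1) ^ (2*H - 1)|)) p)
        ≤ ENNReal.ofReal (C * (t - s) ^ (4*H)) := by
  rcases le_total 0 (2*H - 1) with ha | ha
  · refine ⟨1, one_pos, fun s t _ hst => ?_⟩
    have hL : 0 < t - s := sub_pos.2 hst
    refine (lintegral_simplex_le_of_le_sub
      (h := fun _ => ENNReal.ofReal ((t - s) ^ (2*H - 1) * (t - s) ^ (2*H - 1)))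
      measurable_const fun u z h1 h2 h3 => ENNReal.ofReal_le_ofReal ?_).trans_eq ?_
    · have hle : ∀ x : ℝ, 0 < x → x ≤ t - s → x ^ (2*H - 1) ≤ (t - s) ^ (2*H - 1) :=
        fun x hx hxL => Real.rpow_le_rpow hx.le hxL ha
      have hnn : ∀ x : ℝ, 0 < x → 0 ≤ x ^ (2*H - 1) := fun x hx => Real.rpow_nonneg hx.le _
      gcongr <;> apply abs_sub_le_of_mem_Icc <;> first | apply hnn | apply hle
      all_goals dsimp only; linarith
    · rw [setLIntegral_const, Real.volume_Ioo, sub_zero, ← ENNReal.ofReal_mul (by positivity),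
        ← ENNReal.ofReal_mul hL.le]
      congr 1
      rw [show 4*H = (2*H - 1) + (2*H - 1) + 1 + 1 by ring, Real.rpow_add_one hL.ne',
        Real.rpow_add_one hL.ne', Real.rpow_add hL]
      ring
  · refine ⟨1 / (4*H - 1), one_div_pos.2 (by linarith), fun s t _ hst => ?_⟩
    have hL : 0 < t - s := sub_pos.2 hst
    refine (lintegral_simplex_le_of_le_sub
      (h := fun w => ENNReal.ofReal (w ^ (4*H - 2)))
      (by fun_prop) fun u z h1 h2 h3 => ENNReal.ofReal_le_ofReal ?_).trans_eq ?_
    · have hw : 0 < z - u := sub_pos.2 h2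
      have hle : ∀ x : ℝ, z - u ≤ x → x ^ (2*H - 1) ≤ (z - u) ^ (2*H - 1) :=
        fun x hx => Real.rpow_le_rpow_of_nonpos hw hx ha
      have hnn : ∀ x : ℝ, z - u ≤ x → 0 ≤ x ^ (2*H - 1) :=
        fun x hx => Real.rpow_nonneg (hw.le.trans hx) _
      rw [show 4*H - 2 = (2*H - 1) + (2*H - 1) by ring, Real.rpow_add hw]
      gcongr <;> apply abs_sub_le_of_mem_Icc <;> first | apply hnn | apply hle
      all_goals dsimp only; linarith
    · rw [lintegral_Ioo_rpow (by linarith) hL.le, ← ENNReal.ofReal_mul hL.le]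
      congr 1
      have hpow : (t - s) ^ (4*H) = (t - s) ^ (4*H - 2 + 1) * (t - s) := by
        rw [← Real.rpow_add_one hL.ne']
        ring_nf
      rw [hpow, show 4*H - 1 = 4*H - 2 + 1 by ring]
      ring
end

section
/- Let T > 0, H ∈ (1/4, 1), C > 0, and let R : [0,T]² → ℝ be symmetric, continuous and positive semidefinite (∑_{i,j} c_i c_j R(t_i,t_j) ≥ 0 for all finite real combinations), such that: (i) ∂₁∂₂R exists on the open simplex {0 < u < v < T} with |∂₁∂₂R(u,v)| ≤ C(v−u)^{2H−2}; and (ii) R(t,t) + R(s,s) − 2R(s,t) ≤ C(t−s)^{2H} for all 0 ≤ s ≤ t ≤ T. For a uniform mesh of step ρ define K_ρ(u,v) := ρ^{-2}[R(u⁺,v⁺) − R(u⁻,v⁺) − R(u⁺,v⁻) + R(u⁻,v⁻)], where u⁻ ≤ u < u⁺ and v⁻ ≤ v < v⁺ are the mesh points surrounding u and v. Then for every H' ∈ (1/4, H) there exist C' > 0 and ρ₀ > 0 such that for all ρ ∈ (0, ρ₀] and all 0 ≤ u < v ≤ T, |K_ρ(u,v)| ≤ C' (min(v−u, 1/2))^{2H'−2}.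 -/
open MeasureTheory

/-- The left endpoint `t⁻` of the interval of the uniform mesh of step `ρ` on `[0,T]`
containing `t` (for `t = T` this is the last interval `[T−ρ, T]`). -/
noncomputable def meshBelow (T ρ t : ℝ) : ℝ := min (ρ * (⌊t / ρ⌋ : ℝ)) (T - ρ)

/-- The right endpoint `t⁺ = t⁻ + ρ` of the mesh interval containing `t`. -/
noncomputable def meshAbove (T ρ t : ℝ) : ℝ := meshBelow T ρ t + ρ

/-- The discrete kernel
`K_ρ(u,v) = ρ^{-2}[R(u⁺,v⁺) − R(u⁻,v⁺) − R(u⁺,v⁻) + R(u⁻,v⁻)]`. -/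
noncomputable def discreteKernel (T ρ : ℝ) (R : ℝ → ℝ → ℝ) (u v : ℝ) : ℝ :=
  ρ⁻¹ ^ 2 *
    (R (meshAbove T ρ u) (meshAbove T ρ v) - R (meshBelow T ρ u) (meshAbove T ρ v)
      - R (meshAbove T ρ u) (meshBelow T ρ v) + R (meshBelow T ρ u) (meshBelow T ρ v))

/-- Mean value inequality on a closed rectangle above the diagonal, away from the axis `x = 0`. -/
theorem abs_rectIncrement_le_of_pos {T p C : ℝ} (hp : p ≤ 0) (hC : 0 ≤ C) {R D2 D12 : ℝ → ℝ → ℝ}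
    (hcont : ContinuousOn (fun q : ℝ × ℝ => R q.1 q.2) (Set.Icc 0 T ×ˢ Set.Icc 0 T))
    (hD2 : ∀ u v : ℝ, 0 < u → u < v → v < T → HasDerivAt (fun y => R u y) (D2 u v) v)
    (hD12 : ∀ u v : ℝ, 0 < u → u < v → v < T → HasDerivAt (fun x => D2 x v) (D12 u v) u)
    (hD12bd : ∀ u v : ℝ, 0 < u → u < v → v < T → |D12 u v| ≤ C * (v - u) ^ p)
    {a b c d : ℝ} (ha : 0 < a) (hab : a ≤ b) (hbc : b < c) (hcd : c ≤ d) (hd : d ≤ T) :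
    |R b d - R a d - R b c + R a c| ≤ C * (c - b) ^ p * (b - a) * (d - c) := by
  have hslice : ∀ x, 0 ≤ x → x ≤ T → ContinuousOn (fun y => R x y) (Set.Icc c d) := by
    intro x hx hxT
    refine hcont.comp (f := fun y => (x, y)) (by fun_prop) ?_
    intro y hy
    exact ⟨⟨hx, hxT⟩, ⟨by linarith [hy.1], by linarith [hy.2]⟩⟩
  have hmain := norm_image_sub_le_of_norm_deriv_right_le_segment
    (f := fun y => R b y - R a y) (f' := fun y => D2 b y - D2 a y)
    (C := C * (c - b) ^ p * (b - a)) (a := c) (b := d)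
    ((hslice b (by linarith) (by linarith)).sub (hslice a ha.le (by linarith)))
    (fun y hy => ((hD2 b y (by linarith) (by linarith [hy.1]) (by linarith [hy.2])).sub
      (hD2 a y ha (by linarith [hy.1]) (by linarith [hy.2]))).hasDerivWithinAt)
    (fun y hy => by
      have hder : ∀ x ∈ Set.Icc a b, HasDerivAt (fun x => D2 x y) (D12 x y) x := fun x hx =>
        hD12 x y (by linarith [hx.1]) (by linarith [hx.2, hy.1]) (by linarith [hy.2])
      refine norm_image_sub_le_of_norm_deriv_right_le_segment
        (f := fun x => D2 x y) (f' := fun x => D12 x y)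
        (fun x hx => (hder x hx).continuousAt.continuousWithinAt)
        (fun x hx => (hder x ⟨hx.1, hx.2.le⟩).hasDerivWithinAt) (fun x hx => ?_)
        b ⟨hab, le_rfl⟩
      refine (hD12bd x y (by linarith [hx.1]) (by linarith [hx.2, hy.1])
        (by linarith [hy.2])).trans ?_
      exact mul_le_mul_of_nonneg_left (Real.rpow_le_rpow_of_nonpos (by linarith)
        (by linarith [hx.2, hy.1]) hp) hC)
    d ⟨hcd, le_rfl⟩
  rw [Real.norm_eq_abs] at hmain
  convert hmain using 2
  ring

/-- Mean value inequality on a closed rectangle above the diagonal. -/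
theorem abs_rectIncrement_le {T p C : ℝ} (hp : p ≤ 0) (hC : 0 ≤ C) {R D2 D12 : ℝ → ℝ → ℝ}
    (hcont : ContinuousOn (fun q : ℝ × ℝ => R q.1 q.2) (Set.Icc 0 T ×ˢ Set.Icc 0 T))
    (hD2 : ∀ u v : ℝ, 0 < u → u < v → v < T → HasDerivAt (fun y => R u y) (D2 u v) v)
    (hD12 : ∀ u v : ℝ, 0 < u → u < v → v < T → HasDerivAt (fun x => D2 x v) (D12 u v) u)
    (hD12bd : ∀ u v : ℝ, 0 < u → u < v → v < T → |D12 u v| ≤ C * (v - u) ^ p)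
    {a b c d : ℝ} (ha : 0 ≤ a) (hab : a < b) (hbc : b < c) (hcd : c ≤ d) (hd : d ≤ T) :
    |R b d - R a d - R b c + R a c| ≤ C * (c - b) ^ p * (b - a) * (d - c) := by
  have hslice : ∀ y, 0 ≤ y → y ≤ T → ContinuousWithinAt (fun x => R x y) (Set.Ioo a b) a := by
    intro y hy hyT
    have h : ContinuousOn (fun x => R x y) (Set.Icc a b) := by
      refine hcont.comp (f := fun x => (x, y)) (by fun_prop) ?_
      intro x hx
      exact ⟨⟨by linarith [hx.1], by linarith [hx.2]⟩, ⟨hy, hyT⟩⟩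
    exact (h a ⟨le_rfl, hab.le⟩).mono Set.Ioo_subset_Icc_self
  refine ContinuousWithinAt.closure_le (s := Set.Ioo a b) (x := a)
    (f := fun x => |R b d - R x d - R b c + R x c|)
    (g := fun x => C * (c - b) ^ p * (b - x) * (d - c)) ?_ ?_ ?_ ?_
  · rw [closure_Ioo hab.ne]
    exact ⟨le_rfl, hab.le⟩
  · exact (((continuousWithinAt_const.sub (hslice d (by linarith) hd)).sub
      continuousWithinAt_const).add (hslice c (by linarith) (by linarith))).abs
  · exact Continuous.continuousWithinAt (by fun_prop)
  · intro x hx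
    exact abs_rectIncrement_le_of_pos hp hC hcont hD2 hD12 hD12bd (ha.trans_lt hx.1) hx.2.le
      hbc hcd hd

/-- For a positive semidefinite symmetric kernel, a rectangular increment is dominated by the mean
of the two square increments. -/
theorem two_mul_abs_rectIncrement_le {S : Set ℝ} {R : ℝ → ℝ → ℝ} (hsymm : ∀ x y : ℝ, R x y = R y x)
    (hpsd : ∀ (k : ℕ) (a : Fin k → ℝ) (ts : Fin k → ℝ), (∀ i, ts i ∈ S) →
      0 ≤ ∑ i, ∑ j, a i * a j * R (ts i) (ts j))
    {a b c d : ℝ} (ha : a ∈ S) (hb : b ∈ S) (hc : c ∈ S) (hd : d ∈ S) :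
    2 * |R b d - R a d - R b c + R a c| ≤
      (R b b + R a a - 2 * R a b) + (R d d + R c c - 2 * R c d) := by
  have hts : ∀ i, (![a, b, c, d] : Fin 4 → ℝ) i ∈ S := by
    intro i
    fin_cases i <;> simpa
  have hplus := hpsd 4 ![-1, 1, -1, 1] ![a, b, c, d] hts
  have hminus := hpsd 4 ![-1, 1, 1, -1] ![a, b, c, d] hts
  simp [Fin.sum_univ_four] at hplus hminus
  rw [hsymm b a, hsymm c a, hsymm c b, hsymm d a, hsymm d b, hsymm d c] at hplus hminus
  have : |R b d - R a d - R b c + R a c| ≤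
      ((R b b + R a a - 2 * R a b) + (R d d + R c c - 2 * R c d)) / 2 :=
    abs_le.2 ⟨by linarith, by linarith⟩
  linarith

/-- On a uniform mesh of `N` intervals, `t⁻` is a mesh point `i ρ` with `i < N` and
`t ∈ [t⁻, t⁺]`, where moreover `t < t⁺` unless `i` is the last index. -/
theorem exists_meshBelow_eq {T ρ t : ℝ} {N : ℕ} (hρ : 0 < ρ) (hN : 1 ≤ N) (hT : ρ * (N : ℝ) = T)
    (ht0 : 0 ≤ t) (htT : t ≤ T) :
    ∃ i : ℕ, i + 1 ≤ N ∧ meshBelow T ρ t = ρ * i ∧ ρ * i ≤ t ∧ t ≤ ρ * (i + 1) ∧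
      (i + 1 < N → t < ρ * (i + 1)) := by
  rcases htT.lt_or_eq with hlt | heq
  · have hnn : 0 ≤ t / ρ := by positivity
    have hlow : ρ * (⌊t / ρ⌋₊ : ℝ) ≤ t := by
      have := Nat.floor_le hnn
      rwa [le_div_iff₀' hρ] at this
    have hup : t < ρ * ((⌊t / ρ⌋₊ : ℝ) + 1) := by
      have := Nat.lt_floor_add_one (t / ρ)
      rwa [div_lt_iff₀' hρ] at this
    have hi : ⌊t / ρ⌋₊ + 1 ≤ N := by
      rw [Nat.succ_le_iff, Nat.floor_lt hnn, div_lt_iff₀' hρ]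
      linarith
    refine ⟨⌊t / ρ⌋₊, hi, ?_, hlow, hup.le, fun _ => hup⟩
    have hi' : (⌊t / ρ⌋₊ : ℝ) + 1 ≤ N := by exact_mod_cast hi
    rw [meshBelow, ← natCast_floor_eq_intCast_floor hnn]
    exact min_eq_left (by nlinarith)
  · have hN' : ((N - 1 : ℕ) : ℝ) = N - 1 := by push_cast [hN]; ring
    refine ⟨N - 1, by omega, ?_, ?_, ?_, fun h => absurd h (by omega)⟩
    · have : t / ρ = ((N : ℤ) : ℝ) := by
        rw [heq, ← hT]
        push_cast
        field_simp
      rw [meshBelow, this, Int.floor_intCast, hN', ← hT, min_eq_right]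
      · ring
      · push_cast
        linarith
    · rw [hN']; nlinarith
    · rw [hN', heq, ← hT]; linarith

/-- Under the covariance-derivative bound
`|∂₁∂₂R(u,v)| ≤ C(v−u)^{2H−2}` on the simplex and the on-diagonal square-increment
bound `R(t,t) + R(s,s) − 2R(s,t) ≤ C(t−s)^{2H}`, for every `H' ∈ (1/4,H)` there are
`C' > 0`, `ρ₀ > 0` with `|K_ρ(u,v)| ≤ C' (min(v−u, 1/2))^{2H'−2}` for every uniform
mesh of step `ρ ≤ ρ₀` and all `0 ≤ u < v ≤ T`. -/
theorem stmt18 (T H C : ℝ) (hT : 0 < T) (hH : 1/4 < H) (hH1 : H < 1) (hC : 0 < C)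
    (R : ℝ → ℝ → ℝ)
    (hsymm : ∀ x y : ℝ, R x y = R y x)
    (hcont : ContinuousOn (fun p : ℝ × ℝ => R p.1 p.2) (Set.Icc 0 T ×ˢ Set.Icc 0 T))
    (hpsd : ∀ (k : ℕ) (a : Fin k → ℝ) (ts : Fin k → ℝ), (∀ i, ts i ∈ Set.Icc (0:ℝ) T) →
      0 ≤ ∑ i, ∑ j, a i * a j * R (ts i) (ts j))
    (D2 D12 : ℝ → ℝ → ℝ)
    (hD2 : ∀ u v : ℝ, 0 < u → u < v → v < T → HasDerivAt (fun y => R u y) (D2 u v) v)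
    (hD12 : ∀ u v : ℝ, 0 < u → u < v → v < T → HasDerivAt (fun x => D2 x v) (D12 u v) u)
    (hD12bd : ∀ u v : ℝ, 0 < u → u < v → v < T → |D12 u v| ≤ C * (v - u) ^ (2*H - 2))
    (hsq : ∀ s t : ℝ, 0 ≤ s → s ≤ t → t ≤ T →
      R t t + R s s - 2 * R s t ≤ C * (t - s) ^ (2*H))
    (H' : ℝ) (hH'l : 1/4 < H') (hH'u : H' < H) :
    ∃ C' : ℝ, 0 < C' ∧ ∃ ρ₀ : ℝ, 0 < ρ₀ ∧
      ∀ (ρ : ℝ) (N : ℕ), 0 < ρ → ρ ≤ ρ₀ → 1 ≤ N → ρ * (N : ℝ) = T →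
      ∀ u v : ℝ, 0 ≤ u → u < v → v ≤ T →
        |discreteKernel T ρ R u v| ≤ C' * (min (v - u) (1/2)) ^ (2*H' - 2) := by
  set p : ℝ := 2 * H - 2 with hpdef
  have hp : p ≤ 0 := by linarith
  refine ⟨C * 3⁻¹ ^ p, by positivity, 1, one_pos, ?_⟩
  intro ρ N hρ _ hN hNT u v hu huv hv
  -- It suffices to bound the kernel at some scale comparable to `v - u`.
  suffices h : ∃ w, (v - u) / 3 ≤ w ∧ |discreteKernel T ρ R u v| ≤ C * w ^ p by
    obtain ⟨w, hw, hK⟩ := h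
    have hm : 0 < min (v - u) (1 / 2) := lt_min (by linarith) (by norm_num)
    calc |discreteKernel T ρ R u v| ≤ C * w ^ p := hK
      _ ≤ C * (3⁻¹ * min (v - u) (1 / 2)) ^ p := by
        refine mul_le_mul_of_nonneg_left
          (Real.rpow_le_rpow_of_nonpos (by positivity) ?_ hp) hC.le
        linarith [min_le_left (v - u) (1 / 2)]
      _ = C * 3⁻¹ ^ p * (min (v - u) (1 / 2)) ^ p := by
        rw [Real.mul_rpow (by norm_num) hm.le, mul_assoc]
      _ ≤ C * 3⁻¹ ^ p * (min (v - u) (1 / 2)) ^ (2 * H' - 2) := by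
        refine mul_le_mul_of_nonneg_left (Real.rpow_le_rpow_of_exponent_ge hm ?_ ?_)
          (by positivity)
        · linarith [min_le_right (v - u) (1 / 2)]
        · linarith
  obtain ⟨i, hiN, hi, hiu, hui, -⟩ := exists_meshBelow_eq hρ hN hNT hu (by linarith)
  obtain ⟨j, hjN, hj, hjv, hvj, hvj'⟩ := exists_meshBelow_eq hρ hN hNT (by linarith) hv
  have hij : i ≤ j := by
    by_contra! hlt
    have h1 := hvj' (by omega)
    have h2 : (j : ℝ) + 1 ≤ i := by exact_mod_cast hlt
    nlinarith
  have hiN' : (i : ℝ) + 1 ≤ N := by exact_mod_cast hiN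
  have hjN' : (j : ℝ) + 1 ≤ N := by exact_mod_cast hjN
  have hi0 : 0 ≤ ρ * (i : ℝ) := by positivity
  have hj0 : 0 ≤ ρ * (j : ℝ) := by positivity
  have hiT : ρ * (i : ℝ) + ρ ≤ T := by nlinarith
  have hjT : ρ * (j : ℝ) + ρ ≤ T := by nlinarith
  have hscale : ∀ {Δ W : ℝ}, |Δ| ≤ W * ρ ^ 2 → |ρ⁻¹ ^ 2 * Δ| ≤ W := by
    intro Δ W h
    rw [abs_mul, abs_of_pos (by positivity), inv_pow, inv_mul_le_iff₀ (by positivity)]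
    linarith
  simp only [discreteKernel, meshAbove, hi, hj]
  rcases Nat.lt_or_ge j (i + 2) with hnear | hfar
  · have hnear' : (j : ℝ) ≤ i + 1 := by exact_mod_cast Nat.lt_succ_iff.1 hnear
    refine ⟨ρ, by nlinarith, hscale ?_⟩
    have hCS := two_mul_abs_rectIncrement_le hsymm hpsd (a := ρ * i) (b := ρ * i + ρ)
      (c := ρ * j) (d := ρ * j + ρ) ⟨hi0, by linarith⟩ ⟨by linarith, hiT⟩
      ⟨hj0, by linarith⟩ ⟨by linarith, hjT⟩
    have hI := hsq (ρ * i) (ρ * i + ρ) hi0 (by linarith) hiT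
    have hJ := hsq (ρ * j) (ρ * j + ρ) hj0 (by linarith) hjT
    rw [add_sub_cancel_left] at hI hJ
    have hpow : ρ ^ (2 * H) = ρ ^ p * ρ ^ 2 := by
      rw [← Real.rpow_natCast ρ 2, ← Real.rpow_add hρ]
      congr 1
      push_cast
      linarith
    rw [mul_assoc, ← hpow]
    linarith
  · have hfar' : (i : ℝ) + 2 ≤ j := by exact_mod_cast hfar
    refine ⟨ρ * j - (ρ * i + ρ), by nlinarith, hscale ?_⟩
    refine (abs_rectIncrement_le hp hC.le hcont hD2 hD12 hD12bd hi0 (by linarith)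
      (by nlinarith) (by linarith) hjT).trans_eq ?_
    ring
end
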